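/- Let W ∈ C¹((−∞,1],ℝ) satisfy W(0)=0, W(t)>0 for all t ∈ (−∞,1]\{0}, and W strictly convex, and let k ∈ ℤ\{0}. Then for every ε > 0 there is exactly one solution (f̃_ε, g̃_ε) of the ODE system −f'' − (1/r) f' + (k²/r²) f = (1/ε²) f W'(1 − f² − g²), −g'' − (1/r) g' = (1/ε²) g W'(1 − f² − g²) on (0,1), with f(0)=0, f(1)=1, g'(0)=0, g(1)=0, satisfying f̃_ε > 0 on (0,1) and g̃_ε ≡ 0; equivalently, the scalar boundary value problem −f'' − (1/r) f' + (k²/r²) f = (1/ε²) f W'(1 − f²) on (0,1) with f(0)=0, f(1)=1 has a unique positive solution. -/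

import Mathlib

open MeasureTheory Set Bornology

noncomputable section

/-- Euclidean dot product on `Fin n → ℝ`. -/
def dotR {n : ℕ} (a b : Fin n → ℝ) : ℝ := ∑ j, a j * b j

/-- Squared Euclidean norm on `Fin n → ℝ`. -/
def normSq {n : ℕ} (a : Fin n → ℝ) : ℝ := ∑ j, a j ^ 2

/-- Pointwise (Frobenius) inner product of gradients `∇u · ∇v`. -/
def gradDot {m n : ℕ} (u v : (Fin m → ℝ) → Fin n → ℝ) (x : Fin m → ℝ) : ℝ :=
  ∑ i, ∑ j, fderiv ℝ u x (Pi.single i (1:ℝ)) j * fderiv ℝ v x (Pi.single i (1:ℝ)) j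

/-- `|∇u|²`. -/
def gradSq {m n : ℕ} (u : (Fin m → ℝ) → Fin n → ℝ) (x : Fin m → ℝ) : ℝ := gradDot u u x

/-- Scalar version of `gradDot`. -/
def gradDotS {m : ℕ} (φ ψ : (Fin m → ℝ) → ℝ) (x : Fin m → ℝ) : ℝ :=
  ∑ i, fderiv ℝ φ x (Pi.single i (1:ℝ)) * fderiv ℝ ψ x (Pi.single i (1:ℝ))

/-- `|∇φ|²` for scalar `φ`. -/
def gradSqS {m : ℕ} (φ : (Fin m → ℝ) → ℝ) (x : Fin m → ℝ) : ℝ := gradDotS φ φ x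

/-- `W'`, the (one-sided) derivative of the potential on `(-∞, 1]`. -/
def Wd (W : ℝ → ℝ) : ℝ → ℝ := derivWithin W (Iic (1:ℝ))

/-- The radial ODE system \eqref{syst:ode}-\eqref{syst:bc} for the profiles `(f, g)`. -/
def SolvesSystem (W : ℝ → ℝ) (ε : ℝ) (k : ℤ) (f g : ℝ → ℝ) : Prop :=
  ContinuousOn f (Icc 0 1) ∧ ContinuousOn g (Icc 0 1) ∧
  ContDiffOn ℝ 2 f (Ioo 0 1) ∧ ContDiffOn ℝ 2 g (Ioo 0 1) ∧
  (∀ r ∈ Ioo (0:ℝ) 1,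
    -deriv (deriv f) r - 1 / r * deriv f r + (k : ℝ) ^ 2 / r ^ 2 * f r
      = 1 / ε ^ 2 * f r * Wd W (1 - f r ^ 2 - g r ^ 2)) ∧
  (∀ r ∈ Ioo (0:ℝ) 1,
    -deriv (deriv g) r - 1 / r * deriv g r
      = 1 / ε ^ 2 * g r * Wd W (1 - f r ^ 2 - g r ^ 2)) ∧
  f 0 = 0 ∧ f 1 = 1 ∧ derivWithin g (Icc 0 1) 0 = 0 ∧ g 1 = 0

/-- The weighted primitive from the origin in the variation of constants formula. -/
def eulerInner (κ : ℝ) (h : ℝ → ℝ) (r : ℝ) : ℝ := ∫ s in (0:ℝ)..r, s ^ (κ - 1) * h s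

/-- The weighted primitive from the outer boundary in the variation of constants formula. -/
def eulerOuter (κ : ℝ) (h : ℝ → ℝ) (r : ℝ) : ℝ := ∫ s in r..(1:ℝ), s ^ (-κ - 1) * h s

/-- Explicit solution of `-r² u'' - r u' + κ² u = h` with `u 0 = 0` and `u 1 = 1`. -/
def eulerSolution (κ : ℝ) (h : ℝ → ℝ) (r : ℝ) : ℝ :=
  r ^ κ + (r ^ (-κ) * eulerInner κ h r +
    r ^ κ * (eulerOuter κ h r - eulerInner κ h 1)) / (2 * κ)

/-- `u` solves `-r² u'' - r u' + κ² u = h` on `(0, 1)` with `u 0 = 0` and `u 1 = 1`;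
the witness `p` is `r u'`. -/
structure IsEulerSolution (κ : ℝ) (h u : ℝ → ℝ) : Prop where
  continuousOn : ContinuousOn u (Icc 0 1)
  zero : u 0 = 0
  one : u 1 = 1
  ode : ∃ p : ℝ → ℝ, ∀ r ∈ Ioo (0:ℝ) 1,
    HasDerivAt u (p r / r) r ∧ HasDerivAt p ((κ ^ 2 * u r - h r) / r) r

section EulerOperator

variable {κ : ℝ} {h : ℝ → ℝ}

lemma intervalIntegrable_eulerInner (hκ : 1 ≤ κ) (hh : IntervalIntegrable h volume 0 1) :
    IntervalIntegrable (fun s => s ^ (κ - 1) * h s) volume 0 1 :=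
  hh.continuousOn_mul (Real.continuous_rpow_const (by linarith)).continuousOn

lemma intervalIntegrable_eulerOuter (hh : IntervalIntegrable h volume 0 1) {r : ℝ}
    (hr : r ∈ Ioc (0:ℝ) 1) :
    IntervalIntegrable (fun s => s ^ (-κ - 1) * h s) volume r 1 := by
  refine IntervalIntegrable.continuousOn_mul (hh.mono_set ?_) ?_
  · rw [uIcc_of_le hr.2, uIcc_of_le zero_le_one]
    exact Icc_subset_Icc_left hr.1.le
  · rw [uIcc_of_le hr.2]
    exact fun s hs => (Real.continuousAt_rpow_const s _
      (Or.inl (hr.1.trans_le hs.1).ne')).continuousWithinAt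

lemma continuousOn_eulerSolution_Ioc (hκ : 1 ≤ κ) (hh : IntervalIntegrable h volume 0 1) :
    ContinuousOn (eulerSolution κ h) (Ioc 0 1) := by
  have hA : ContinuousOn (eulerInner κ h) (Ioc 0 1) := by
    have := intervalIntegral.continuousOn_primitive_interval'
      (intervalIntegrable_eulerInner hκ hh) (a := 0) (by simp)
    rw [uIcc_of_le zero_le_one] at this
    exact this.mono Ioc_subset_Icc_self
  have hB : ContinuousOn (eulerOuter κ h) (Ioc 0 1) := by
    intro r hr
    have hr2 : r / 2 ∈ Ioc (0:ℝ) 1 := ⟨by linarith [hr.1], by linarith [hr.1, hr.2]⟩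
    have := intervalIntegral.continuousOn_primitive_interval'
      (intervalIntegrable_eulerOuter (κ := κ) hh hr2) (a := 1) (by simp)
    rw [uIcc_of_le hr2.2] at this
    have h2 := (this r ⟨by linarith [hr.1], hr.2⟩).neg
    have h3 : ContinuousWithinAt (eulerOuter κ h) (Icc (r / 2) 1) r := by
      refine h2.congr (fun x _ => ?_) ?_ <;>
        exact intervalIntegral.integral_symm _ _
    refine h3.mono_of_mem_nhdsWithin ?_
    filter_upwards [self_mem_nhdsWithin,
      mem_nhdsWithin_of_mem_nhds (Ioi_mem_nhds (show r / 2 < r by linarith [hr.1]))] with x hx hx2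
    exact ⟨le_of_lt hx2, hx.2⟩
  have hp : ∀ a : ℝ, ContinuousOn (fun r : ℝ => r ^ a) (Ioc 0 1) := fun a r hr =>
    (Real.continuousAt_rpow_const r a (Or.inl hr.1.ne')).continuousWithinAt
  exact (hp κ).add ((((hp (-κ)).mul hA).add
    ((hp κ).mul (hB.sub continuousOn_const))).div_const _)

lemma eulerSolution_one (h : ℝ → ℝ) : eulerSolution κ h 1 = 1 := by
  simp [eulerSolution, eulerOuter]

lemma eulerSolution_zero (hκ : 1 ≤ κ) (h : ℝ → ℝ) : eulerSolution κ h 0 = 0 := by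
  have h1 : κ ≠ 0 := by linarith
  simp [eulerSolution, Real.zero_rpow h1, Real.zero_rpow (neg_ne_zero.mpr h1)]

lemma eulerSolution_ode (hκ : 1 ≤ κ) (hh : ContinuousOn h (Icc 0 1)) :
    ∃ p : ℝ → ℝ, ∀ r ∈ Ioo (0:ℝ) 1, HasDerivAt (eulerSolution κ h) (p r / r) r ∧
      HasDerivAt p ((κ ^ 2 * eulerSolution κ h r - h r) / r) r := by
  have hhi : IntervalIntegrable h volume 0 1 :=
    ContinuousOn.intervalIntegrable (by rwa [uIcc_of_le zero_le_one])
  have hcont : ∀ a : ℝ, ContinuousOn (fun s : ℝ => s ^ a * h s) (Ioo 0 1) := fun a =>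
    ContinuousOn.mul (fun r hr =>
      (Real.continuousAt_rpow_const r a (Or.inl hr.1.ne')).continuousWithinAt)
      (hh.mono Ioo_subset_Icc_self)
  refine ⟨fun r => κ * r ^ κ + (-(r ^ (-κ) * eulerInner κ h r) +
    r ^ κ * (eulerOuter κ h r - eulerInner κ h 1)) / 2, fun r hr => ?_⟩
  have hr0 : 0 < r := hr.1
  have hA : HasDerivAt (eulerInner κ h) (r ^ (κ - 1) * h r) r :=
    intervalIntegral.integral_hasDerivAt_right
      ((intervalIntegrable_eulerInner hκ hhi).mono_set (by
        rw [uIcc_of_le hr.1.le, uIcc_of_le zero_le_one]; exact Icc_subset_Icc_right hr.2.le))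
      ((hcont _).stronglyMeasurableAtFilter isOpen_Ioo r hr)
      ((hcont _).continuousAt (isOpen_Ioo.mem_nhds hr))
  have hB : HasDerivAt (eulerOuter κ h) (-(r ^ (-κ - 1) * h r)) r :=
    intervalIntegral.integral_hasDerivAt_left
      (intervalIntegrable_eulerOuter hhi ⟨hr.1, hr.2.le⟩)
      ((hcont _).stronglyMeasurableAtFilter isOpen_Ioo r hr)
      ((hcont _).continuousAt (isOpen_Ioo.mem_nhds hr))
  have h1 : HasDerivAt (fun x : ℝ => x ^ κ) (κ * r ^ (κ - 1)) r :=
    Real.hasDerivAt_rpow_const (Or.inl hr0.ne')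
  have h2 : HasDerivAt (fun x : ℝ => x ^ (-κ)) (-κ * r ^ (-κ - 1)) r :=
    Real.hasDerivAt_rpow_const (Or.inl hr0.ne')
  have e1 : r ^ (κ - 1) = r ^ κ / r := Real.rpow_sub_one hr0.ne' κ
  have e2 : r ^ (-κ - 1) = (r ^ κ)⁻¹ / r := by
    rw [Real.rpow_sub_one hr0.ne', Real.rpow_neg hr0.le]
  have e3 : r ^ (-κ) = (r ^ κ)⁻¹ := Real.rpow_neg hr0.le κ
  have hX : 0 < r ^ κ := Real.rpow_pos_of_pos hr0 κ
  constructor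
  · have := h1.add (((h2.mul hA).add (h1.mul (hB.sub_const (eulerInner κ h 1)))).div_const (2 * κ))
    refine this.congr_deriv ?_
    simp only [e1, e2, e3]
    field_simp
    ring
  · have := (h1.const_mul κ).add
      (((h2.mul hA).neg.add (h1.mul (hB.sub_const (eulerInner κ h 1)))).div_const 2)
    refine this.congr_deriv ?_
    simp only [eulerSolution, e1, e2, e3]
    field_simp
    ring

lemma tendsto_eulerSolution_zero (hκ : 1 ≤ κ) (hh : ContinuousOn h (Icc 0 1)) (h0 : h 0 = 0) :
    Filter.Tendsto (eulerSolution κ h) (nhdsWithin 0 (Ioi 0)) (nhds 0) := by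
  have hκ0 : 0 < κ := by linarith
  have hhi : IntervalIntegrable h volume 0 1 :=
    ContinuousOn.intervalIntegrable (by rwa [uIcc_of_le zero_le_one])
  have hpow : Filter.Tendsto (fun r : ℝ => r ^ κ) (nhdsWithin 0 (Ioi 0)) (nhds 0) := by
    have := (Real.continuous_rpow_const hκ0.le).tendsto (0:ℝ)
    rw [Real.zero_rpow hκ0.ne'] at this
    exact this.mono_left nhdsWithin_le_nhds
  have hsmall : ∀ η > 0, ∃ δ ∈ Ioo (0:ℝ) 1, ∀ s ∈ Ioc 0 δ, |h s| ≤ η := by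
    intro η hη
    obtain ⟨δ, hδ, H⟩ := Metric.continuousWithinAt_iff.mp (hh 0 (by simp)) η hη
    refine ⟨min (δ / 2) (1 / 2), ⟨by positivity, by
      linarith [min_le_right (δ / 2) (1 / 2 : ℝ)]⟩, fun s hs => ?_⟩
    have h1 := hs.2.trans (min_le_left _ _)
    have h2 := hs.2.trans (min_le_right _ _)
    have := H (x := s) ⟨hs.1.le, by linarith⟩ (by
      rw [Real.dist_eq, sub_zero, abs_of_pos hs.1]; linarith)
    rw [h0, Real.dist_eq, sub_zero] at this
    exact this.le
  have hA : Filter.Tendsto (fun r : ℝ => r ^ (-κ) * eulerInner κ h r)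
      (nhdsWithin 0 (Ioi 0)) (nhds 0) := by
    rw [Metric.tendsto_nhds]
    intro η hη
    obtain ⟨δ, hδ, H⟩ := hsmall (η / 2) (by positivity)
    filter_upwards [Ioo_mem_nhdsGT hδ.1] with r hr
    have hX : 0 < r ^ κ := Real.rpow_pos_of_pos hr.1 κ
    have key : ‖eulerInner κ h r‖ ≤ ∫ s in (0:ℝ)..r, s ^ (κ - 1) * (η / 2) := by
      refine intervalIntegral.norm_integral_le_of_norm_le hr.1.le
        (Filter.Eventually.of_forall fun s hs => ?_) ?_
      · rw [norm_mul, Real.norm_of_nonneg (Real.rpow_nonneg hs.1.le _)]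
        exact mul_le_mul_of_nonneg_left (H s ⟨hs.1, hs.2.trans hr.2.le⟩)
          (Real.rpow_nonneg hs.1.le _)
      · exact ((Real.continuous_rpow_const (by linarith)).mul
          continuous_const).intervalIntegrable _ _
    rw [intervalIntegral.integral_mul_const, integral_rpow (Or.inl (by linarith)),
      sub_add_cancel, Real.zero_rpow hκ0.ne', sub_zero] at key
    rw [dist_zero_right, norm_mul, Real.norm_of_nonneg (Real.rpow_nonneg hr.1.le _),
      Real.rpow_neg hr.1.le]
    calc (r ^ κ)⁻¹ * ‖eulerInner κ h r‖ ≤ (r ^ κ)⁻¹ * (r ^ κ / κ * (η / 2)) := by gcongr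
      _ = (η / 2) / κ := by field_simp
      _ ≤ η / 2 := div_le_self (by positivity) hκ
      _ < η := by linarith
  have hB : Filter.Tendsto (fun r : ℝ => r ^ κ * eulerOuter κ h r)
      (nhdsWithin 0 (Ioi 0)) (nhds 0) := by
    rw [Metric.tendsto_nhds]
    intro η hη
    obtain ⟨δ, hδ, H⟩ := hsmall (η / 2) (by positivity)
    have hfar := hpow.mul_const |eulerOuter κ h δ|
    rw [zero_mul] at hfar
    filter_upwards [Ioo_mem_nhdsGT hδ.1, hfar.eventually_lt_const (half_pos hη)] with r hr hr2
    have hX : 0 < r ^ κ := Real.rpow_pos_of_pos hr.1 κ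
    have hY : 0 < δ ^ κ := Real.rpow_pos_of_pos hδ.1 κ
    have hi1 := intervalIntegrable_eulerOuter (κ := κ) hhi
      (show r ∈ Ioc (0:ℝ) 1 from ⟨hr.1, (hr.2.trans hδ.2).le⟩)
    have hi2 := intervalIntegrable_eulerOuter (κ := κ) hhi
      (show δ ∈ Ioc (0:ℝ) 1 from ⟨hδ.1, hδ.2.le⟩)
    have hsplit : eulerOuter κ h r = (∫ s in r..δ, s ^ (-κ - 1) * h s) + eulerOuter κ h δ :=
      (intervalIntegral.integral_add_adjacent_intervals (hi1.trans hi2.symm) hi2).symm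
    have hnot : (0:ℝ) ∉ uIcc r δ := by
      rw [uIcc_of_le hr.2.le]; exact fun hx => absurd hx.1 (not_le.mpr hr.1)
    have key : ‖∫ s in r..δ, s ^ (-κ - 1) * h s‖ ≤ ∫ s in r..δ, s ^ (-κ - 1) * (η / 2) := by
      refine intervalIntegral.norm_integral_le_of_norm_le hr.2.le
        (Filter.Eventually.of_forall fun s hs => ?_) ?_
      · have hs0 := hr.1.trans hs.1
        rw [norm_mul, Real.norm_of_nonneg (Real.rpow_nonneg hs0.le _)]
        exact mul_le_mul_of_nonneg_left (H s ⟨hs0, hs.2⟩) (Real.rpow_nonneg hs0.le _)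
      · exact (intervalIntegral.intervalIntegrable_rpow (Or.inr hnot)).mul_const _
    rw [intervalIntegral.integral_mul_const, integral_rpow (Or.inr ⟨by linarith, hnot⟩),
      sub_add_cancel, Real.rpow_neg hr.1.le, Real.rpow_neg hδ.1.le] at key
    rw [dist_zero_right, norm_mul, Real.norm_of_nonneg hX.le, hsplit]
    calc r ^ κ * ‖(∫ s in r..δ, s ^ (-κ - 1) * h s) + eulerOuter κ h δ‖
        ≤ r ^ κ * (‖∫ s in r..δ, s ^ (-κ - 1) * h s‖ + ‖eulerOuter κ h δ‖) := by
          gcongr; exact norm_add_le _ _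
      _ ≤ r ^ κ * (((δ ^ κ)⁻¹ - (r ^ κ)⁻¹) / (-κ) * (η / 2) + ‖eulerOuter κ h δ‖) := by gcongr
      _ = (1 - r ^ κ / δ ^ κ) / κ * (η / 2) + r ^ κ * |eulerOuter κ h δ| := by
          rw [Real.norm_eq_abs]; field_simp; ring
      _ ≤ 1 * (η / 2) + r ^ κ * |eulerOuter κ h δ| := by
          gcongr
          rw [div_le_one hκ0]
          have : 0 < r ^ κ / δ ^ κ := by positivity
          linarith
      _ < η := by linarith
  have := hpow.add ((hA.add (hB.sub (hpow.mul_const (eulerInner κ h 1)))).div_const (2 * κ))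
  simp only [zero_mul, sub_zero, add_zero, zero_div] at this
  refine this.congr fun r => ?_
  simp only [eulerSolution]
  ring

lemma isEulerSolution_eulerSolution (hκ : 1 ≤ κ) (hh : ContinuousOn h (Icc 0 1)) (h0 : h 0 = 0) :
    IsEulerSolution κ h (eulerSolution κ h) := by
  refine ⟨?_, eulerSolution_zero hκ h, eulerSolution_one h, eulerSolution_ode hκ hh⟩
  have hhi : IntervalIntegrable h volume 0 1 :=
    ContinuousOn.intervalIntegrable (by rwa [uIcc_of_le zero_le_one])
  intro r hr
  rcases hr.1.eq_or_lt with rfl | hr0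
  · rw [← continuousWithinAt_sdiff_self]
    have hsub : Icc (0:ℝ) 1 \ {0} ⊆ Ioi 0 := fun x hx => lt_of_le_of_ne hx.1.1 (Ne.symm hx.2)
    rw [ContinuousWithinAt, eulerSolution_zero hκ h]
    exact (tendsto_eulerSolution_zero hκ hh h0).mono_left (nhdsWithin_mono _ hsub)
  · refine (continuousOn_eulerSolution_Ioc hκ hhi r ⟨hr0, hr.2⟩).mono_of_mem_nhdsWithin ?_
    filter_upwards [self_mem_nhdsWithin, mem_nhdsWithin_of_mem_nhds (Ioi_mem_nhds hr0)]
      with x hx hx2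
    exact ⟨hx2, hx.2⟩

end EulerOperator

section Comparison

/-- Maximum principle for `v` with `p = r v'`. -/
lemma nonpos_of_euler_deriv_pos {v p q : ℝ → ℝ} (hv : ContinuousOn v (Icc 0 1))
    (h0 : v 0 ≤ 0) (h1 : v 1 ≤ 0)
    (hd : ∀ r ∈ Ioo (0:ℝ) 1, HasDerivAt v (p r / r) r ∧ HasDerivAt p (q r) r)
    (hq : ∀ r ∈ Ioo (0:ℝ) 1, 0 < v r → 0 < q r) :
    ∀ r ∈ Icc (0:ℝ) 1, v r ≤ 0 := by
  by_contra! hcon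
  obtain ⟨r₁, hr₁, hvr₁⟩ := hcon
  obtain ⟨c, hc, hmax⟩ := isCompact_Icc.exists_isMaxOn ⟨r₁, hr₁⟩ hv
  have hvc : 0 < v c := hvr₁.trans_le (hmax hr₁)
  have hcI : c ∈ Ioo (0:ℝ) 1 := by
    refine ⟨lt_of_le_of_ne hc.1 ?_, lt_of_le_of_ne hc.2 ?_⟩
    · rintro rfl; linarith
    · rintro rfl; linarith
  have hpc : p c = 0 := by
    have hloc : IsLocalMax v c := hmax.isLocalMax (Icc_mem_nhds hcI.1 hcI.2)
    have := hloc.hasDerivAt_eq_zero (hd c hcI).1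
    rcases div_eq_zero_iff.mp this with h | h
    · exact h
    · exact absurd h hcI.1.ne'
  have hslope := (hasDerivAt_iff_tendsto_slope.mp (hd c hcI).2).eventually_const_lt
    (hq c hcI hvc)
  have hright : ∀ᶠ x in nhdsWithin c (Ioi c), 0 < slope p c x :=
    hslope.filter_mono (nhdsWithin_mono _ fun x hx => ne_of_gt hx)
  obtain ⟨d, hd1, hd2⟩ := mem_nhdsGT_iff_exists_Ioo_subset.mp
    (Filter.inter_mem hright (Ioo_mem_nhdsGT hcI.2))
  have hcd : c < d := hd1
  have hpos : ∀ x ∈ Ioo c d, x < 1 ∧ 0 < p x := by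
    intro x hx
    have := hd2 hx
    refine ⟨this.2.2, ?_⟩
    have hs : 0 < slope p c x := this.1
    rw [slope_def_field, hpc, sub_zero] at hs
    exact (div_pos_iff_of_pos_right (sub_pos.mpr hx.1)).mp hs
  set e := (c + d) / 2 with he
  have hce : c < e := by rw [he]; linarith
  have hed : e < d := by rw [he]; linarith
  have hmono : StrictMonoOn v (Icc c e) := by
    refine strictMonoOn_of_hasDerivWithinAt_pos (f' := fun r => p r / r) (convex_Icc c e)
      (hv.mono (Icc_subset_Icc hcI.1.le (hpos e ⟨hce, hed⟩).1.le)) ?_ ?_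
    · intro x hx
      rw [interior_Icc] at hx
      have := hpos x ⟨hx.1, hx.2.trans hed⟩
      exact (hd x ⟨hcI.1.trans hx.1, this.1⟩).1.hasDerivWithinAt
    · intro x hx
      rw [interior_Icc] at hx
      exact div_pos (hpos x ⟨hx.1, hx.2.trans hed⟩).2 (hcI.1.trans hx.1)
  have h2 := hmono (left_mem_Icc.mpr hce.le) (right_mem_Icc.mpr hce.le) hce
  have h3 : v e ≤ v c := hmax ⟨(hcI.1.trans hce).le, (hpos e ⟨hce, hed⟩).1.le⟩
  linarith

/-- Solutions with ordered right-hand sides are ordered. -/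
lemma IsEulerSolution.le_of_le {κ : ℝ} (hκ : 0 < κ) {h₁ h₂ u₁ u₂ : ℝ → ℝ}
    (H₁ : IsEulerSolution κ h₁ u₁) (H₂ : IsEulerSolution κ h₂ u₂)
    (hle : ∀ r ∈ Ioo (0:ℝ) 1, h₁ r ≤ h₂ r) : ∀ r ∈ Icc (0:ℝ) 1, u₁ r ≤ u₂ r := by
  obtain ⟨p₁, hp₁⟩ := H₁.ode
  obtain ⟨p₂, hp₂⟩ := H₂.ode
  have := nonpos_of_euler_deriv_pos (v := fun r => u₁ r - u₂ r) (p := fun r => p₁ r - p₂ r)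
    (q := fun r => (κ ^ 2 * u₁ r - h₁ r) / r - (κ ^ 2 * u₂ r - h₂ r) / r)
    (H₁.continuousOn.sub H₂.continuousOn) (by simp [H₁.zero, H₂.zero])
    (by simp [H₁.one, H₂.one])
    (fun r hr => ⟨((hp₁ r hr).1.sub (hp₂ r hr).1).congr_deriv (by ring),
      (hp₁ r hr).2.sub (hp₂ r hr).2⟩)
    (fun r hr hv => by
      rw [← sub_div]
      refine div_pos ?_ hr.1
      have := mul_pos (pow_pos hκ 2) hv
      linarith [hle r hr])
  exact fun r hr => sub_nonpos.mp (this r hr)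

lemma IsEulerSolution.le_one {κ : ℝ} {h u : ℝ → ℝ} (H : IsEulerSolution κ h u) (hκ : 0 < κ)
    (hle : ∀ r ∈ Ioo (0:ℝ) 1, h r ≤ κ ^ 2) : ∀ r ∈ Icc (0:ℝ) 1, u r ≤ 1 := by
  obtain ⟨p, hp⟩ := H.ode
  have := nonpos_of_euler_deriv_pos (v := fun r => u r - 1) (p := p)
    (q := fun r => (κ ^ 2 * u r - h r) / r) (H.continuousOn.sub continuousOn_const)
    (by simp [H.zero]) (by simp [H.one])
    (fun r hr => ⟨(hp r hr).1.sub_const 1, (hp r hr).2⟩)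
    (fun r hr hv => by
      refine div_pos ?_ hr.1
      have := mul_pos (pow_pos hκ 2) hv
      linarith [hle r hr])
  exact fun r hr => sub_nonpos.mp (this r hr)

lemma IsEulerSolution.eqOn {κ : ℝ} (hκ : 0 < κ) {h u₁ u₂ : ℝ → ℝ}
    (H₁ : IsEulerSolution κ h u₁) (H₂ : IsEulerSolution κ h u₂) : EqOn u₁ u₂ (Icc 0 1) :=
  fun r hr => le_antisymm (H₁.le_of_le hκ H₂ (fun _ _ => le_rfl) r hr)
    (H₂.le_of_le hκ H₁ (fun _ _ => le_rfl) r hr)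

/-- A zeroth-order term can be moved between the operator and the right-hand side. -/
lemma IsEulerSolution.shift {κ κ' : ℝ} {h h' u : ℝ → ℝ} (H : IsEulerSolution κ h u)
    (hs : ∀ r ∈ Ioo (0:ℝ) 1, κ ^ 2 * u r - h r = κ' ^ 2 * u r - h' r) :
    IsEulerSolution κ' h' u := by
  obtain ⟨p, hp⟩ := H.ode
  exact ⟨H.continuousOn, H.zero, H.one, p, fun r hr => ⟨(hp r hr).1, hs r hr ▸ (hp r hr).2⟩⟩

lemma isEulerSolution_rpow {κ : ℝ} (hκ : 0 < κ) : IsEulerSolution κ (fun _ => 0) (· ^ κ) := by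
  refine ⟨(Real.continuous_rpow_const hκ.le).continuousOn, Real.zero_rpow hκ.ne',
    Real.one_rpow κ, fun r => κ * r ^ κ, fun r hr => ?_⟩
  have h1 : HasDerivAt (fun x : ℝ => x ^ κ) (κ * r ^ (κ - 1)) r :=
    Real.hasDerivAt_rpow_const (Or.inl hr.1.ne')
  rw [Real.rpow_sub_one hr.1.ne'] at h1
  exact ⟨h1.congr_deriv (by ring), (h1.const_mul κ).congr_deriv (by ring)⟩

end Comparison

section LipschitzApproximation

/-- The `n`-Lipschitz lower envelope of `F`. -/
def lipschitzEnvelope (F : ℝ → ℝ) (n : ℕ) (x : ℝ) : ℝ := ⨅ v : ℝ, (F v + n * |x - v|)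

variable {F : ℝ → ℝ}

lemma bddBelow_lipschitzEnvelope (hF : ∀ x, 0 ≤ F x) (n : ℕ) (x : ℝ) :
    BddBelow (range fun v : ℝ => F v + n * |x - v|) :=
  ⟨0, by rintro _ ⟨v, rfl⟩; have := hF v; positivity⟩

lemma lipschitzEnvelope_nonneg (hF : ∀ x, 0 ≤ F x) (n : ℕ) (x : ℝ) :
    0 ≤ lipschitzEnvelope F n x :=
  le_ciInf fun v => by have := hF v; positivity

lemma lipschitzEnvelope_le (hF : ∀ x, 0 ≤ F x) (n : ℕ) (x : ℝ) :
    lipschitzEnvelope F n x ≤ F x :=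
  (ciInf_le (bddBelow_lipschitzEnvelope hF n x) x).trans (by simp)

lemma lipschitzEnvelope_le_succ (hF : ∀ x, 0 ≤ F x) (n : ℕ) (x : ℝ) :
    lipschitzEnvelope F n x ≤ lipschitzEnvelope F (n + 1) x :=
  ciInf_mono (bddBelow_lipschitzEnvelope hF n x) fun v => by
    push_cast
    nlinarith [abs_nonneg (x - v)]

lemma lipschitzEnvelope_le_add (hF : ∀ x, 0 ≤ F x) (n : ℕ) (x y : ℝ) :
    lipschitzEnvelope F n x ≤ lipschitzEnvelope F n y + n * |x - y| := by
  rw [← sub_le_iff_le_add]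
  refine le_ciInf fun v => ?_
  have h1 := ciInf_le (bddBelow_lipschitzEnvelope hF n x) v
  have h2 := mul_le_mul_of_nonneg_left (abs_sub_le x y v) (Nat.cast_nonneg (α := ℝ) n)
  rw [lipschitzEnvelope]
  linarith

lemma continuous_lipschitzEnvelope (hF : ∀ x, 0 ≤ F x) (n : ℕ) :
    Continuous (lipschitzEnvelope F n) := by
  refine (LipschitzWith.of_dist_le_mul (K := n) fun x y => ?_).continuous
  rw [Real.dist_eq, Real.dist_eq, abs_le]
  have h1 := lipschitzEnvelope_le_add hF n x y
  have h2 := lipschitzEnvelope_le_add hF n y x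
  rw [abs_sub_comm] at h2
  simp only [NNReal.coe_natCast]
  constructor <;> linarith

lemma tendsto_lipschitzEnvelope (hFc : Continuous F) (hF : ∀ x, 0 ≤ F x) {x : ℝ} {u : ℕ → ℝ}
    (hu : Filter.Tendsto u Filter.atTop (nhds x)) :
    Filter.Tendsto (fun n => lipschitzEnvelope F n (u n)) Filter.atTop (nhds (F x)) := by
  refine tendsto_order.mpr ⟨fun a ha => ?_, fun a ha => ?_⟩
  · obtain ⟨b, hab, hb⟩ := exists_between ha
    obtain ⟨δ, hδ, H⟩ := Metric.eventually_nhds_iff.mp ((hFc.tendsto x).eventually_const_lt hb)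
    have hn : ∀ᶠ n : ℕ in Filter.atTop, b ≤ n * (δ / 2) :=
      (tendsto_natCast_atTop_atTop.atTop_mul_const (half_pos hδ)).eventually_ge_atTop b
    filter_upwards [hn, Metric.tendsto_nhds.mp hu (δ / 2) (half_pos hδ)] with n hn hun
    refine hab.trans_le (le_ciInf fun v => ?_)
    rcases lt_or_ge |u n - v| (δ / 2) with h | h
    · have : dist v x < δ := by
        calc dist v x ≤ dist v (u n) + dist (u n) x := dist_triangle _ _ _
          _ < δ := by rw [dist_comm v, Real.dist_eq]; linarith
      have h1 := H this
      have : 0 ≤ n * |u n - v| := by positivity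
      linarith
    · have := mul_le_mul_of_nonneg_left h (Nat.cast_nonneg (α := ℝ) n)
      linarith [hF v]
  · filter_upwards [((hFc.tendsto x).comp hu).eventually_lt_const ha] with n hn
    exact (lipschitzEnvelope_le hF n _).trans_lt hn

end LipschitzApproximation

section Existence

/-- `u` is a subsolution, with values in `[0, 1]`, of the problem whose nonlinearity is the
`n`-Lipschitz lower envelope of `F`. -/
structure IsEnvelopeSubsolution (κ : ℝ) (F : ℝ → ℝ) (n : ℕ) (u : ℝ → ℝ) : Prop where
  ode : ∃ h, IsEulerSolution κ h u ∧
    ∀ r ∈ Ioo (0:ℝ) 1, h r ≤ r ^ 2 * lipschitzEnvelope F n (u r)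
  mem_Icc : ∀ r ∈ Icc (0:ℝ) 1, u r ∈ Icc (0:ℝ) 1

variable {κ : ℝ} {F : ℝ → ℝ}

lemma isEnvelopeSubsolution_rpow (hκ : 1 ≤ κ) (hF : ∀ x, 0 ≤ F x) :
    IsEnvelopeSubsolution κ F 0 (· ^ κ) where
  ode := ⟨_, isEulerSolution_rpow (by linarith), fun r _ =>
    mul_nonneg (sq_nonneg r) (lipschitzEnvelope_nonneg hF 0 _)⟩
  mem_Icc := fun _ hr => ⟨Real.rpow_nonneg hr.1 _, Real.rpow_le_one hr.1 hr.2 (by linarith)⟩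

/-- One step of the monotone iteration. -/
lemma IsEnvelopeSubsolution.exists_next (hκ : 1 ≤ κ) (hF : ∀ x, 0 ≤ F x) (hF1 : F 1 = 0)
    {n : ℕ} {u : ℝ → ℝ} (H : IsEnvelopeSubsolution κ F n u) :
    ∃ u' : ℝ → ℝ, IsEnvelopeSubsolution κ F (n + 1) u' ∧
      IsEulerSolution κ (fun r => r ^ 2 * lipschitzEnvelope F n (u r) +
        (n + 1) * (u r - u' r)) u' ∧ ∀ r ∈ Icc (0:ℝ) 1, u r ≤ u' r := by
  obtain ⟨⟨h, hu, hh⟩, hmem⟩ := H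
  set M : ℝ := n + 1 with hM
  have hM0 : 0 < M := by positivity
  set μ : ℝ := √(κ ^ 2 + M) with hμ
  have hμsq : μ ^ 2 = κ ^ 2 + M := Real.sq_sqrt (by positivity)
  have hμ1 : 1 ≤ μ := Real.one_le_sqrt.mpr (by nlinarith)
  have hμ0 : 0 < μ := by linarith
  set G : ℝ → ℝ := fun r => r ^ 2 * lipschitzEnvelope F n (u r) + M * u r with hG
  have hGc : ContinuousOn G (Icc 0 1) :=
    ((continuousOn_id.pow 2).mul
      ((continuous_lipschitzEnvelope hF n).comp_continuousOn hu.continuousOn)).add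
      (continuousOn_const.mul hu.continuousOn)
  have hG0 : G 0 = 0 := by simp [hG, hu.zero]
  have hu' := isEulerSolution_eulerSolution hμ1 hGc hG0
  set u' := eulerSolution μ G
  have hEnv : ∀ r ∈ Icc (0:ℝ) 1, ∀ x y : ℝ, x ≤ y →
      r ^ 2 * lipschitzEnvelope F n x ≤ r ^ 2 * lipschitzEnvelope F n y + n * (y - x) := by
    intro r hr x y hxy
    have h1 := lipschitzEnvelope_le_add hF n x y
    rw [abs_sub_comm, abs_of_nonneg (sub_nonneg.mpr hxy)] at h1
    have h2 : r ^ 2 ≤ 1 := pow_le_one₀ hr.1 hr.2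
    have h3 : 0 ≤ (n : ℝ) * (y - x) := mul_nonneg n.cast_nonneg (sub_nonneg.mpr hxy)
    nlinarith [mul_le_mul_of_nonneg_left h1 (sq_nonneg r)]
  have hle1 : ∀ r ∈ Icc (0:ℝ) 1, u' r ≤ 1 := by
    refine hu'.le_one hμ0 fun r hr => ?_
    have hrI := Ioo_subset_Icc_self hr
    have h1 := hEnv r hrI (u r) 1 (hmem r hrI).2
    have h2 : r ^ 2 * lipschitzEnvelope F n 1 ≤ 0 :=
      mul_nonpos_of_nonneg_of_nonpos (sq_nonneg r) (hF1 ▸ lipschitzEnvelope_le hF n 1)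
    have h3 := hmem r hrI
    rw [hμsq]
    simp only [hG, hM]
    nlinarith [h3.1, h3.2, sq_nonneg κ]
  have hmono : ∀ r ∈ Icc (0:ℝ) 1, u r ≤ u' r := by
    have hs : IsEulerSolution μ (fun r => h r + M * u r) u :=
      hu.shift fun r _ => by rw [hμsq]; ring
    exact hs.le_of_le hμ0 hu' fun r hr => by simpa [hG] using hh r hr
  have hsol : IsEulerSolution κ (fun r => r ^ 2 * lipschitzEnvelope F n (u r) +
      M * (u r - u' r)) u' := hu'.shift fun r _ => by rw [hμsq]; simp only [hG]; ring
  refine ⟨u', ⟨⟨_, hsol, fun r hr => ?_⟩, fun r hr =>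
    ⟨(hmem r hr).1.trans (hmono r hr), hle1 r hr⟩⟩, hsol, hmono⟩
  have hrI := Ioo_subset_Icc_self hr
  have h1 := hEnv r hrI (u r) (u' r) (hmono r hrI)
  have h2 := mul_le_mul_of_nonneg_left (lipschitzEnvelope_le_succ hF n (u' r)) (sq_nonneg r)
  have h3 := hmono r hrI
  simp only [hM]
  linarith

lemma exists_envelope_iteration (hκ : 1 ≤ κ) (hF : ∀ x, 0 ≤ F x) (hF1 : F 1 = 0) :
    ∃ u : ℕ → ℝ → ℝ, (u 0 = (· ^ κ)) ∧
      (∀ n, IsEnvelopeSubsolution κ F n (u n)) ∧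
      (∀ n, IsEulerSolution κ (fun r => r ^ 2 * lipschitzEnvelope F n (u n r) +
        (n + 1) * (u n r - u (n + 1) r)) (u (n + 1))) ∧
      ∀ n, ∀ r ∈ Icc (0:ℝ) 1, u n r ≤ u (n + 1) r := by
  choose next h1 h2 h3 using fun (n : ℕ) (u : {u // IsEnvelopeSubsolution κ F n u}) =>
    u.2.exists_next hκ hF hF1
  let seq : ∀ n : ℕ, {u // IsEnvelopeSubsolution κ F n u} := fun n =>
    Nat.rec ⟨_, isEnvelopeSubsolution_rpow hκ hF⟩ (fun n u => ⟨next n u, h1 n u⟩) n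
  exact ⟨fun n => (seq n).1, rfl, fun n => (seq n).2, fun n => h2 n (seq n),
    fun n => h3 n (seq n)⟩

/-- For fixed `r > 0` the explicit solution depends continuously on the right-hand side
in `L¹(0, 1)`. -/
lemma tendsto_eulerSolution_of_L1 (hκ : 1 ≤ κ) {h : ℕ → ℝ → ℝ} {g : ℝ → ℝ}
    (hh : ∀ n, IntervalIntegrable (h n) volume 0 1) (hg : IntervalIntegrable g volume 0 1)
    (hlim : Filter.Tendsto (fun n => ∫ s in (0:ℝ)..1, |h n s - g s|) Filter.atTop (nhds 0))
    {r : ℝ} (hr : r ∈ Ioc (0:ℝ) 1) :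
    Filter.Tendsto (fun n => eulerSolution κ (h n) r) Filter.atTop
      (nhds (eulerSolution κ g r)) := by
  have hdi : ∀ n, IntervalIntegrable (fun s => |h n s - g s|) volume 0 1 :=
    fun n => ((hh n).sub hg).abs
  have hsub : ∀ {a b : ℝ}, 0 ≤ a → a ≤ b → b ≤ 1 → uIcc a b ⊆ uIcc (0:ℝ) 1 := by
    intro a b ha hab hb
    rw [uIcc_of_le hab, uIcc_of_le zero_le_one]
    exact Icc_subset_Icc ha hb
  have hA : ∀ x ∈ Ioc (0:ℝ) 1, Filter.Tendsto (fun n => eulerInner κ (h n) x) Filter.atTop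
      (nhds (eulerInner κ g x)) := by
    intro x hx
    rw [tendsto_iff_norm_sub_tendsto_zero]
    refine squeeze_zero (fun n => norm_nonneg _) (fun n => ?_) hlim
    have e1 := (intervalIntegrable_eulerInner hκ (hh n)).mono_set (hsub le_rfl hx.1.le hx.2)
    have e2 := (intervalIntegrable_eulerInner hκ hg).mono_set (hsub le_rfl hx.1.le hx.2)
    rw [eulerInner, eulerInner, ← intervalIntegral.integral_sub e1 e2]
    refine (intervalIntegral.norm_integral_le_of_norm_le hx.1.le
      (Filter.Eventually.of_forall fun s hs => ?_)
      ((hdi n).mono_set (hsub le_rfl hx.1.le hx.2))).trans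
      (intervalIntegral.integral_mono_interval le_rfl hx.1.le hx.2
        (Filter.Eventually.of_forall fun s => abs_nonneg _) (hdi n))
    rw [← mul_sub, norm_mul, Real.norm_of_nonneg (Real.rpow_nonneg hs.1.le _)]
    exact mul_le_of_le_one_left (norm_nonneg _)
      (Real.rpow_le_one hs.1.le (hs.2.trans hx.2) (by linarith))
  have hB : Filter.Tendsto (fun n => eulerOuter κ (h n) r) Filter.atTop
      (nhds (eulerOuter κ g r)) := by
    have hlim' := hlim.const_mul (r ^ (-κ - 1))
    rw [mul_zero] at hlim'
    rw [tendsto_iff_norm_sub_tendsto_zero]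
    refine squeeze_zero (fun n => norm_nonneg _) (fun n => ?_) hlim'
    rw [eulerOuter, eulerOuter, ← intervalIntegral.integral_sub
      (intervalIntegrable_eulerOuter (hh n) hr) (intervalIntegrable_eulerOuter hg hr)]
    refine (intervalIntegral.norm_integral_le_of_norm_le hr.2
      (Filter.Eventually.of_forall fun s hs => ?_)
      (((hdi n).const_mul (r ^ (-κ - 1))).mono_set (hsub hr.1.le hr.2 le_rfl))).trans ?_
    · rw [← mul_sub, norm_mul, Real.norm_of_nonneg (Real.rpow_nonneg (hr.1.trans hs.1).le _)]
      exact mul_le_mul_of_nonneg_right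
        (Real.rpow_le_rpow_of_nonpos hr.1 hs.1.le (by linarith)) (norm_nonneg _)
    · rw [intervalIntegral.integral_const_mul]
      exact mul_le_mul_of_nonneg_left (intervalIntegral.integral_mono_interval hr.1.le hr.2 le_rfl
        (Filter.Eventually.of_forall fun s => abs_nonneg _) (hdi n)) (Real.rpow_nonneg hr.1.le _)
  exact tendsto_const_nhds.add ((((hA r hr).const_mul _).add
    ((hB.sub (hA 1 ⟨one_pos, le_rfl⟩)).const_mul _)).div_const _)

/-- A summable nonnegative sequence is `o(1/n)` along a subsequence. -/
lemma exists_subseq_tendsto_mul_of_summable {a : ℕ → ℝ} (ha : ∀ n, 0 ≤ a n) (hs : Summable a) :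
    ∃ φ : ℕ → ℕ, StrictMono φ ∧
      Filter.Tendsto (fun n => ((φ n : ℝ) + 1) * a (φ n)) Filter.atTop (nhds 0) := by
  have hfreq : ∀ η > 0, ∃ᶠ n : ℕ in Filter.atTop, ((n : ℝ) + 1) * a n < η := by
    intro η hη hcon
    obtain ⟨N, hN⟩ := Filter.eventually_atTop.mp hcon
    have hs2 : Summable fun n : ℕ => η * (1 / ((n : ℝ) + 1)) := by
      rw [← summable_nat_add_iff N]
      refine Summable.of_nonneg_of_le (fun n => by positivity) (fun n => ?_)
        ((summable_nat_add_iff N).mpr hs)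
      have := not_lt.mp (hN (n + N) (by omega))
      rw [mul_one_div, div_le_iff₀ (by positivity)]
      linarith
    have hs3 := (summable_mul_left_iff hη.ne').mp hs2
    refine Real.not_summable_one_div_natCast ((summable_nat_add_iff 1).mp ?_)
    simpa using hs3
  obtain ⟨φ, hφ, H⟩ := Filter.extraction_forall_of_frequently
    fun n : ℕ => hfreq (1 / ((n : ℝ) + 1)) (by positivity)
  exact ⟨φ, hφ, squeeze_zero (fun n => mul_nonneg (by positivity) (ha _)) (fun n => (H n).le)
    tendsto_one_div_add_atTop_nhds_zero_nat⟩

/-- Existence for `-r² u'' - r u' + κ² u = r² F(u)`, `u 0 = 0`, `u 1 = 1`, with a merely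
continuous nonlinearity. -/
theorem exists_isEulerSolution_nonlinear (hκ : 1 ≤ κ) (hFc : Continuous F) (hF : ∀ x, 0 ≤ F x)
    {C : ℝ} (hFC : ∀ x, F x ≤ C) (hF1 : F 1 = 0) :
    ∃ f : ℝ → ℝ, IsEulerSolution κ (fun r => r ^ 2 * F (f r)) f ∧
      ∀ r ∈ Icc (0:ℝ) 1, r ^ κ ≤ f r ∧ f r ≤ 1 := by
  have hκ0 : 0 < κ := by linarith
  obtain ⟨u, hu0, hsub, hsol, hstep⟩ := exists_envelope_iteration hκ hF hF1
  have hcont : ∀ n, ContinuousOn (u n) (Icc 0 1) := fun n => by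
    obtain ⟨h, hh, -⟩ := (hsub n).ode
    exact hh.continuousOn
  have hmono : ∀ r ∈ Icc (0:ℝ) 1, Monotone fun n => u n r := fun r hr =>
    monotone_nat_of_le_succ fun n => hstep n r hr
  have hlim : ∀ r ∈ Icc (0:ℝ) 1,
      Filter.Tendsto (fun n => u n r) Filter.atTop (nhds (⨆ n, u n r)) := fun r hr =>
    tendsto_atTop_ciSup (hmono r hr) ⟨1, by rintro _ ⟨n, rfl⟩; exact ((hsub n).mem_Icc r hr).2⟩
  set v : ℝ → ℝ := fun r => ⨆ n, u n r with hv
  set g : ℝ → ℝ := fun r => r ^ 2 * F (v r) with hg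
  have hIoc : uIoc (0:ℝ) 1 ⊆ Icc 0 1 := by
    rw [uIoc_of_le zero_le_one]; exact Ioc_subset_Icc_self
  have hInt : ∀ {w : ℝ → ℝ}, ContinuousOn w (Icc 0 1) → IntervalIntegrable w volume 0 1 :=
    fun hw => ContinuousOn.intervalIntegrable (by rwa [uIcc_of_le zero_le_one])
  set e : ℕ → ℝ → ℝ := fun n r => r ^ 2 * lipschitzEnvelope F n (u n r) with he
  have hec : ∀ n, ContinuousOn (e n) (Icc 0 1) := fun n => (continuousOn_id.pow 2).mul
    ((continuous_lipschitzEnvelope hF n).comp_continuousOn (hcont n))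
  have helim : ∀ r ∈ Icc (0:ℝ) 1, Filter.Tendsto (fun n => e n r) Filter.atTop (nhds (g r)) :=
    fun r hr => (tendsto_lipschitzEnvelope hFc hF (hlim r hr)).const_mul _
  have hebd : ∀ n, ∀ r ∈ Icc (0:ℝ) 1, |e n r| ≤ C := by
    intro n r hr
    have h0 := lipschitzEnvelope_nonneg hF n (u n r)
    have h1 := (lipschitzEnvelope_le hF n (u n r)).trans (hFC _)
    rw [abs_of_nonneg (mul_nonneg (sq_nonneg r) h0)]
    exact (mul_le_of_le_one_left h0 (pow_le_one₀ hr.1 hr.2)).trans h1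
  have hgbd : ∀ r ∈ Icc (0:ℝ) 1, |g r| ≤ C := fun r hr =>
    le_of_tendsto (helim r hr).abs (Filter.Eventually.of_forall fun n => hebd n r hr)
  have hem : ∀ n, AEStronglyMeasurable (e n) (volume.restrict (uIoc (0:ℝ) 1)) := fun n =>
    ((hec n).mono hIoc).aestronglyMeasurable measurableSet_uIoc
  have hgm : AEStronglyMeasurable g (volume.restrict (uIoc (0:ℝ) 1)) :=
    aestronglyMeasurable_of_tendsto_ae Filter.atTop hem
      ((ae_restrict_iff' measurableSet_uIoc).mpr
        (Filter.Eventually.of_forall fun r hr => helim r (hIoc hr)))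
  have hgi : IntervalIntegrable g volume 0 1 :=
    (intervalIntegrable_const (c := C)).mono_fun' hgm
      ((ae_restrict_iff' measurableSet_uIoc).mpr
        (Filter.Eventually.of_forall fun r hr => hgbd r (hIoc hr)))
  have hconv : Filter.Tendsto (fun n => ∫ s in (0:ℝ)..1, |e n s - g s|) Filter.atTop
      (nhds 0) := by
    have := intervalIntegral.tendsto_integral_filter_of_dominated_convergence
      (μ := volume) (a := 0) (b := 1) (l := Filter.atTop) (f := fun _ => (0:ℝ))
      (F := fun n s => |e n s - g s|) (fun _ => C + C)
      (Filter.Eventually.of_forall fun n => ((hem n).sub hgm).norm)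
      (Filter.Eventually.of_forall fun n => Filter.Eventually.of_forall fun s hs => by
        rw [Real.norm_eq_abs, abs_abs]
        exact (abs_sub _ _).trans (add_le_add (hebd n s (hIoc hs)) (hgbd s (hIoc hs))))
      intervalIntegrable_const
      (Filter.Eventually.of_forall fun s hs => by
        have := ((helim s (hIoc hs)).sub_const (g s)).abs
        rwa [sub_self, abs_zero] at this)
    simpa using this
  set a : ℕ → ℝ := fun n => ∫ s in (0:ℝ)..1, (u (n + 1) s - u n s) with ha
  have ha0 : ∀ n, 0 ≤ a n := fun n => intervalIntegral.integral_nonneg zero_le_one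
    fun s hs => sub_nonneg.mpr (hstep n s hs)
  have hasum : Summable a := by
    refine summable_of_sum_range_le (c := 1) ha0 fun N => ?_
    have htel : ∀ n, a n = (∫ s in (0:ℝ)..1, u (n + 1) s) - ∫ s in (0:ℝ)..1, u n s := fun n =>
      intervalIntegral.integral_sub (hInt (hcont _)) (hInt (hcont _))
    simp only [htel]
    rw [Finset.sum_range_sub (fun n => ∫ s in (0:ℝ)..1, u n s)]
    have h1 : ∫ s in (0:ℝ)..1, u N s ≤ ∫ _ in (0:ℝ)..1, (1:ℝ) :=
      intervalIntegral.integral_mono_on zero_le_one (hInt (hcont N)) intervalIntegrable_const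
        fun s hs => ((hsub N).mem_Icc s hs).2
    have h2 : 0 ≤ ∫ s in (0:ℝ)..1, u 0 s := intervalIntegral.integral_nonneg zero_le_one
      fun s hs => ((hsub 0).mem_Icc s hs).1
    simp only [intervalIntegral.integral_const, sub_zero, smul_eq_mul, mul_one] at h1
    linarith
  obtain ⟨φ, hφ, hφlim⟩ := exists_subseq_tendsto_mul_of_summable ha0 hasum
  set w : ℕ → ℝ → ℝ := fun n r => e n r + (n + 1) * (u n r - u (n + 1) r) with hw
  have hwc : ∀ n, ContinuousOn (w n) (Icc 0 1) := fun n =>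
    (hec n).add (continuousOn_const.mul ((hcont n).sub (hcont (n + 1))))
  have hL1 : Filter.Tendsto (fun n => ∫ s in (0:ℝ)..1, |w (φ n) s - g s|) Filter.atTop
      (nhds 0) := by
    have hsum := (hconv.comp hφ.tendsto_atTop).add hφlim
    rw [add_zero] at hsum
    refine squeeze_zero (fun n => intervalIntegral.integral_nonneg zero_le_one
      fun s _ => abs_nonneg _) (fun n => ?_) hsum
    have i1 : IntervalIntegrable (fun s => |e (φ n) s - g s|) volume 0 1 :=
      ((hInt (hec (φ n))).sub hgi).abs
    have i2 : IntervalIntegrable (fun s => ((φ n : ℝ) + 1) * (u (φ n + 1) s - u (φ n) s))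
        volume 0 1 := (hInt ((hcont _).sub (hcont _))).const_mul _
    simp only [Function.comp, ha]
    rw [← intervalIntegral.integral_const_mul, ← intervalIntegral.integral_add i1 i2]
    refine intervalIntegral.integral_mono_on zero_le_one ((hInt (hwc _)).sub hgi).abs
      (i1.add i2) fun s hs => ?_
    have h1 : w (φ n) s - g s =
        (e (φ n) s - g s) - ((φ n : ℝ) + 1) * (u (φ n + 1) s - u (φ n) s) := by
      simp only [hw]; ring
    have h2 : 0 ≤ ((φ n : ℝ) + 1) * (u (φ n + 1) s - u (φ n) s) :=
      mul_nonneg (by positivity) (sub_nonneg.mpr (hstep _ s hs))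
    rw [h1]
    exact (abs_sub _ _).trans_eq (by rw [abs_of_nonneg h2])
  have hrep : ∀ n, EqOn (u (n + 1)) (eulerSolution κ (w n)) (Icc 0 1) := fun n => by
    refine (hsol n).eqOn hκ0 (isEulerSolution_eulerSolution hκ (hwc n) ?_)
    obtain ⟨h, hh, -⟩ := (hsub n).ode
    simp [hh.zero, (hsol n).zero]
  have hveq : EqOn v (eulerSolution κ g) (Icc 0 1) := by
    intro r hr
    rcases hr.1.eq_or_lt with rfl | hr0
    · rw [eulerSolution_zero hκ]
      refine tendsto_nhds_unique ((hlim 0 hr).comp (Filter.tendsto_add_atTop_nat 1)) ?_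
      exact tendsto_const_nhds.congr fun n => ((hsol n).zero).symm
    · refine tendsto_nhds_unique ((hlim r hr).comp
        ((Filter.tendsto_add_atTop_nat 1).comp hφ.tendsto_atTop)) ?_
      exact (tendsto_eulerSolution_of_L1 hκ (fun n => hInt (hwc (φ n))) hgi hL1
        ⟨hr0, hr.2⟩).congr fun n => (hrep (φ n) hr).symm
  have hgc : ContinuousOn g (Icc 0 1) := by
    intro r hr
    rcases hr.1.eq_or_lt with rfl | hr0
    · have hsq : Filter.Tendsto (fun r : ℝ => r ^ 2 * C) (nhdsWithin 0 (Icc 0 1)) (nhds 0) := by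
        have : Filter.Tendsto (fun r : ℝ => r ^ 2 * C) (nhds 0) (nhds (0 ^ 2 * C)) :=
          (Continuous.tendsto (by fun_prop) 0)
        rw [zero_pow two_ne_zero, zero_mul] at this
        exact this.mono_left nhdsWithin_le_nhds
      have hg0 : g 0 = 0 := by simp [hg]
      rw [ContinuousWithinAt, hg0]
      exact squeeze_zero (fun s => mul_nonneg (sq_nonneg s) (hF _))
        (fun s => mul_le_mul_of_nonneg_left (hFC _) (sq_nonneg s)) hsq
    · have h1 : ContinuousOn v (Ioc 0 1) := (continuousOn_eulerSolution_Ioc hκ hgi).congr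
        (hveq.mono Ioc_subset_Icc_self)
      have h2 : ContinuousOn g (Ioc 0 1) :=
        (continuousOn_id.pow 2).mul (hFc.comp_continuousOn h1)
      refine (h2 r ⟨hr0, hr.2⟩).mono_of_mem_nhdsWithin ?_
      filter_upwards [self_mem_nhdsWithin, mem_nhdsWithin_of_mem_nhds (Ioi_mem_nhds hr0)]
        with x hx hx2
      exact ⟨hx2, hx.2⟩
  refine ⟨eulerSolution κ g, (isEulerSolution_eulerSolution hκ hgc (by simp [hg])).shift
    fun r hr => ?_, fun r hr => ?_⟩
  · rw [← hveq (Ioo_subset_Icc_self hr)]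
  · rw [← hveq hr]
    refine ⟨?_, le_of_tendsto (hlim r hr)
      (Filter.Eventually.of_forall fun n => ((hsub n).mem_Icc r hr).2)⟩
    have := (hmono r hr).ge_of_tendsto (hlim r hr) 0
    simpa only [hu0] using this

end Existence

section Uniqueness

variable {κ : ℝ} {φ f p : ℝ → ℝ}

/-- `r f'` stays bounded near the origin for a positive solution vanishing there. -/
lemma exists_bound_euler_deriv_near_zero (hκ : 0 < κ) (hφ : AntitoneOn φ (Ici 0))
    (hf : ContinuousOn f (Icc 0 1)) (hf0 : f 0 = 0) (hpos : ∀ r ∈ Ioo (0:ℝ) 1, 0 < f r)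
    (hode : ∀ r ∈ Ioo (0:ℝ) 1, HasDerivAt f (p r / r) r ∧
      HasDerivAt p ((κ ^ 2 * f r - r ^ 2 * (f r * φ (f r))) / r) r) :
    ∃ P : ℝ, ∀ᶠ r in nhdsWithin (0:ℝ) (Ioi 0), |p r| ≤ P := by
  have hsmall : ∀ᶠ r in nhdsWithin (0:ℝ) (Ioi 0), r ^ 2 * φ 0 < κ ^ 2 := by
    have : Filter.Tendsto (fun r : ℝ => r ^ 2 * φ 0) (nhds 0) (nhds (0 ^ 2 * φ 0)) :=
      Continuous.tendsto (by fun_prop) 0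
    rw [zero_pow two_ne_zero, zero_mul] at this
    exact (this.mono_left nhdsWithin_le_nhds).eventually_lt_const (by positivity)
  obtain ⟨d, hd0, hd⟩ := mem_nhdsGT_iff_exists_Ioo_subset.mp
    (Filter.inter_mem hsmall (Ioo_mem_nhdsGT one_pos))
  have hd0 : (0:ℝ) < d := hd0
  have hd1 : ∀ r ∈ Ioo 0 d, r ∈ Ioo (0:ℝ) 1 := fun r hr => (hd hr).2
  have hmono : MonotoneOn p (Ioo 0 d) := by
    refine monotoneOn_of_hasDerivWithinAt_nonneg (convex_Ioo 0 d)
      (fun r hr => (hode r (hd1 r hr)).2.continuousAt.continuousWithinAt)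
      (fun r hr => (hode r (hd1 r (interior_subset hr))).2.hasDerivWithinAt) fun r hr => ?_
    have hr := interior_subset hr
    have hfr := hpos r (hd1 r hr)
    have h1 : φ (f r) ≤ φ 0 := hφ (mem_Ici.mpr le_rfl) hfr.le hfr.le
    have h2 : r ^ 2 * φ 0 < κ ^ 2 := (hd hr).1
    have h3 := mul_le_mul_of_nonneg_left h1 (sq_nonneg r)
    refine div_nonneg ?_ hr.1.le
    have : 0 ≤ f r * (κ ^ 2 - r ^ 2 * φ (f r)) := mul_nonneg hfr.le (by linarith)
    linarith
  have hnonneg : ∀ r ∈ Ioo 0 d, 0 ≤ p r := by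
    intro r hr
    by_contra! hneg
    have hanti : AntitoneOn f (Icc 0 r) := by
      refine antitoneOn_of_hasDerivWithinAt_nonpos (f' := fun r => p r / r) (convex_Icc 0 r)
        (hf.mono (Icc_subset_Icc_right (hd1 r hr).2.le)) ?_ ?_
      · intro x hx
        rw [interior_Icc] at hx
        exact (hode x (hd1 x ⟨hx.1, hx.2.trans hr.2⟩)).1.hasDerivWithinAt
      · intro x hx
        rw [interior_Icc] at hx
        exact div_nonpos_of_nonpos_of_nonneg
          ((hmono ⟨hx.1, hx.2.trans hr.2⟩ hr hx.2.le).trans hneg.le) hx.1.le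
    have h1 := hanti (left_mem_Icc.mpr hr.1.le) (right_mem_Icc.mpr hr.1.le) hr.1.le
    linarith [hpos r (hd1 r hr)]
  refine ⟨p (d / 2), ?_⟩
  filter_upwards [Ioo_mem_nhdsGT (half_pos hd0)] with r hr
  have hrd : r ∈ Ioo 0 d := ⟨hr.1, by linarith [hr.2]⟩
  rw [abs_of_nonneg (hnonneg r hrd)]
  exact hmono hrd ⟨half_pos hd0, by linarith⟩ hr.2.le

variable {g q : ℝ → ℝ}

lemma le_of_positive_euler_solutions (hκ : 0 < κ) (hφ : StrictAntiOn φ (Ici 0))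
    (hf : ContinuousOn f (Icc 0 1)) (hf0 : f 0 = 0) (hf1 : f 1 = 1)
    (hfpos : ∀ r ∈ Ioo (0:ℝ) 1, 0 < f r)
    (hfode : ∀ r ∈ Ioo (0:ℝ) 1, HasDerivAt f (p r / r) r ∧
      HasDerivAt p ((κ ^ 2 * f r - r ^ 2 * (f r * φ (f r))) / r) r)
    (hg : ContinuousOn g (Icc 0 1)) (hg0 : g 0 = 0) (hg1 : g 1 = 1)
    (hgpos : ∀ r ∈ Ioo (0:ℝ) 1, 0 < g r)
    (hgode : ∀ r ∈ Ioo (0:ℝ) 1, HasDerivAt g (q r / r) r ∧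
      HasDerivAt q ((κ ^ 2 * g r - r ^ 2 * (g r * φ (g r))) / r) r) :
    ∀ r ∈ Icc (0:ℝ) 1, f r ≤ g r := by
  by_contra! hcon
  obtain ⟨c, hc, hgt⟩ := hcon
  have hcI : c ∈ Ioo (0:ℝ) 1 := by
    refine ⟨lt_of_le_of_ne hc.1 ?_, lt_of_le_of_ne hc.2 ?_⟩
    · rintro rfl; linarith
    · rintro rfl; linarith
  have hfg : ContinuousOn (fun r => f r - g r) (Icc 0 1) := hf.sub hg
  have hclosed : ∀ x y : ℝ, 0 ≤ x → y ≤ 1 → IsCompact {r ∈ Icc x y | f r - g r ≤ 0} := by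
    intro x y hx hy
    exact isCompact_Icc.of_isClosed_subset
      ((hfg.mono (Icc_subset_Icc hx hy)).preimage_isClosed_of_isClosed isClosed_Icc isClosed_Iic)
      (sep_subset _ _)
  obtain ⟨a, ⟨haI, ha⟩, hamax⟩ := (hclosed 0 c le_rfl hc.2).exists_isGreatest
    ⟨0, ⟨le_rfl, hc.1⟩, by simp [hf0, hg0]⟩
  obtain ⟨b, ⟨hbI, hb⟩, hbmin⟩ := (hclosed c 1 hc.1 le_rfl).exists_isLeast
    ⟨1, ⟨hc.2, le_rfl⟩, by simp [hf1, hg1]⟩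
  have hac : a < c := lt_of_le_of_ne haI.2 (by rintro rfl; linarith)
  have hcb : c < b := lt_of_le_of_ne hbI.1 (by rintro rfl; linarith)
  have hin : ∀ r ∈ Ioo a b, r ∈ Ioo (0:ℝ) 1 := fun r hr =>
    ⟨haI.1.trans_lt hr.1, hr.2.trans_le hbI.2⟩
  have hlt : ∀ r ∈ Ioo a b, g r < f r := by
    intro r hr
    by_contra! hle
    rcases le_total r c with h | h
    · exact absurd (hamax ⟨⟨(hin r hr).1.le, h⟩, sub_nonpos.mpr hle⟩) (not_le.mpr hr.1)
    · exact absurd (hbmin ⟨⟨h, (hin r hr).2.le⟩, sub_nonpos.mpr hle⟩) (not_le.mpr hr.2)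
  set D : ℝ → ℝ := fun r => p r * g r - f r * q r with hD
  have hDd : ∀ r ∈ Ioo (0:ℝ) 1,
      HasDerivAt D (r * (f r * g r) * (φ (g r) - φ (f r))) r := by
    intro r hr
    have h := ((hfode r hr).2.mul (hgode r hr).1).sub ((hfode r hr).1.mul (hgode r hr).2)
    refine h.congr_deriv ?_
    have := hr.1.ne'
    field_simp
    ring
  have hDmono : StrictMonoOn D (Ioo a b) := by
    refine strictMonoOn_of_hasDerivWithinAt_pos (convex_Ioo a b)
      (fun r hr => (hDd r (hin r hr)).continuousAt.continuousWithinAt)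
      (fun r hr => (hDd r (hin r (interior_subset hr))).hasDerivWithinAt) fun r hr => ?_
    have hr := interior_subset hr
    have hr01 := hin r hr
    have h1 := hφ (hgpos r hr01).le (hfpos r hr01).le (hlt r hr)
    exact mul_pos (mul_pos hr01.1 (mul_pos (hfpos r hr01) (hgpos r hr01))) (sub_pos.mpr h1)
  have hQd : ∀ r ∈ Ioo (0:ℝ) 1, HasDerivAt (fun r => f r / g r) (D r / (r * g r ^ 2)) r := by
    intro r hr
    have hgr := (hgpos r hr).ne'
    refine ((hfode r hr).1.div (hgode r hr).1 hgr).congr_deriv ?_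
    have := hr.1.ne'
    simp only [hD]
    field_simp
  have hgpos' : ∀ r ∈ Ioc (0:ℝ) 1, 0 < g r := by
    intro r hr
    rcases hr.2.eq_or_lt with rfl | h
    · rw [hg1]; exact one_pos
    · exact hgpos r ⟨hr.1, h⟩
  have hQc : ∀ x y : ℝ, 0 < x → y ≤ 1 → ContinuousOn (fun r => f r / g r) (Icc x y) := by
    intro x y hx hy
    exact (hf.mono (Icc_subset_Icc hx.le hy)).div (hg.mono (Icc_subset_Icc hx.le hy))
      fun r hr => (hgpos' r ⟨hx.trans_le hr.1, hr.2.trans hy⟩).ne'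
  have hcab : c ∈ Ioo a b := ⟨hac, hcb⟩
  have hQc1 : 1 < f c / g c := (one_lt_div (hgpos c hcI)).mpr hgt
  have hDc : D c < 0 := by
    by_contra! hDc
    have hmono : MonotoneOn (fun r => f r / g r) (Icc c b) := by
      refine monotoneOn_of_hasDerivWithinAt_nonneg (f' := fun r => D r / (r * g r ^ 2))
        (convex_Icc c b) (hQc c b hcI.1 hbI.2) ?_ ?_
      · intro r hr
        rw [interior_Icc] at hr
        exact (hQd r (hin r ⟨hac.trans hr.1, hr.2⟩)).hasDerivWithinAt
      · intro r hr
        rw [interior_Icc] at hr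
        have hrab : r ∈ Ioo a b := ⟨hac.trans hr.1, hr.2⟩
        exact div_nonneg (hDc.trans (hDmono hcab hrab hr.1).le)
          (mul_nonneg (hin r hrab).1.le (sq_nonneg _))
    have h1 : f c / g c ≤ f b / g b :=
      hmono (left_mem_Icc.mpr hcb.le) (right_mem_Icc.mpr hcb.le) hcb.le
    have h2 : f b / g b ≤ 1 :=
      (div_le_one (hgpos' b ⟨hcI.1.trans hcb, hbI.2⟩)).mpr (sub_nonpos.mp hb)
    linarith
  have hDleft : ∀ r ∈ Ioo a c, D r ≤ D c := fun r hr =>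
    (hDmono ⟨hr.1, hr.2.trans hcb⟩ hcab hr.2).le
  rcases haI.1.eq_or_lt with rfl | ha0
  · obtain ⟨P, hP⟩ := exists_bound_euler_deriv_near_zero hκ hφ.antitoneOn hf hf0 hfpos hfode
    obtain ⟨Q, hQ⟩ := exists_bound_euler_deriv_near_zero hκ hφ.antitoneOn hg hg0 hgpos hgode
    have hle : nhdsWithin (0:ℝ) (Ioi 0) ≤ nhdsWithin 0 (Icc 0 1) :=
      nhdsWithin_le_of_mem (Icc_mem_nhdsGT one_pos)
    have hf' : Filter.Tendsto f (nhdsWithin 0 (Ioi 0)) (nhds 0) := by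
      have := (hf 0 (by simp)).tendsto
      rw [hf0] at this
      exact this.mono_left hle
    have hg' : Filter.Tendsto g (nhdsWithin 0 (Ioi 0)) (nhds 0) := by
      have := (hg 0 (by simp)).tendsto
      rw [hg0] at this
      exact this.mono_left hle
    have h1 : Filter.Tendsto (fun r => p r * g r) (nhdsWithin 0 (Ioi 0)) (nhds 0) :=
      (hg'.zero_mul_isBoundedUnder_le ⟨P, hP⟩).congr fun r => mul_comm _ _
    have h2 : Filter.Tendsto (fun r => f r * q r) (nhdsWithin 0 (Ioi 0)) (nhds 0) :=
      hf'.zero_mul_isBoundedUnder_le ⟨Q, hQ⟩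
    have h3 : Filter.Tendsto D (nhdsWithin 0 (Ioi 0)) (nhds 0) := by
      simpa using h1.sub h2
    have h4 : (0:ℝ) ≤ D c := le_of_tendsto h3 (by
      filter_upwards [Ioo_mem_nhdsGT hac] with r hr using hDleft r hr)
    linarith
  · have hanti : AntitoneOn (fun r => f r / g r) (Icc a c) := by
      refine antitoneOn_of_hasDerivWithinAt_nonpos (f' := fun r => D r / (r * g r ^ 2))
        (convex_Icc a c) (hQc a c ha0 hc.2) ?_ ?_
      · intro r hr
        rw [interior_Icc] at hr
        exact (hQd r (hin r ⟨hr.1, hr.2.trans hcb⟩)).hasDerivWithinAt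
      · intro r hr
        rw [interior_Icc] at hr
        exact div_nonpos_of_nonpos_of_nonneg ((hDleft r hr).trans hDc.le)
          (mul_nonneg (ha0.trans hr.1).le (sq_nonneg _))
    have h1 : f c / g c ≤ f a / g a :=
      hanti (left_mem_Icc.mpr hac.le) (right_mem_Icc.mpr hac.le) hac.le
    have h2 : f a / g a ≤ 1 :=
      (div_le_one (hgpos' a ⟨ha0, (hac.trans hcI.2).le⟩)).mpr (sub_nonpos.mp ha)
    linarith

end Uniqueness

section Potential

variable {W : ℝ → ℝ}

lemma strictMonoOn_Wd (hW : ContDiffOn ℝ 1 W (Iic (1:ℝ)))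
    (hWconv : StrictConvexOn ℝ (Iic (1:ℝ)) W) : StrictMonoOn (Wd W) (Iic 1) :=
  hWconv.strictMonoOn_derivWithin (hW.differentiableOn one_ne_zero)

lemma continuousOn_Wd (hW : ContDiffOn ℝ 1 W (Iic (1:ℝ))) : ContinuousOn (Wd W) (Iic 1) :=
  hW.continuousOn_derivWithin (uniqueDiffOn_Iic 1) le_rfl

lemma Wd_zero (hW0 : W 0 = 0) (hWpos : ∀ t ∈ Iic (1:ℝ), t ≠ 0 → 0 < W t) : Wd W 0 = 0 := by
  have hn : Iic (1:ℝ) ∈ nhds 0 := Iic_mem_nhds one_pos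
  rw [Wd, derivWithin_of_mem_nhds hn]
  refine IsLocalMin.deriv_eq_zero ?_
  filter_upwards [hn] with t ht
  rw [hW0]
  rcases eq_or_ne t 0 with rfl | h
  · exact hW0.ge
  · exact (hWpos t ht h).le

lemma strictAntiOn_scaled_Wd (hW : ContDiffOn ℝ 1 W (Iic (1:ℝ)))
    (hWconv : StrictConvexOn ℝ (Iic (1:ℝ)) W) {ε : ℝ} (hε : 0 < ε) :
    StrictAntiOn (fun x => 1 / ε ^ 2 * Wd W (1 - x ^ 2)) (Ici 0) := by
  intro x hx y hy hxy
  refine mul_lt_mul_of_pos_left (strictMonoOn_Wd hW hWconv ?_ ?_ ?_) (by positivity)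
  · exact sub_le_self 1 (sq_nonneg y)
  · exact sub_le_self 1 (sq_nonneg x)
  · exact sub_lt_sub_left (pow_lt_pow_left₀ hxy hx two_ne_zero) 1

end Potential

section RadialSystem

variable {W f g : ℝ → ℝ} {ε : ℝ} {k : ℤ}

lemma SolvesSystem.hasDerivAt_of_eq_zero (H : SolvesSystem W ε k f g)
    (hg : ∀ r ∈ Icc (0:ℝ) 1, g r = 0) : ∀ r ∈ Ioo (0:ℝ) 1,
      HasDerivAt f ((r * deriv f r) / r) r ∧ HasDerivAt (fun r => r * deriv f r)
        ((|(k:ℝ)| ^ 2 * f r - r ^ 2 * (f r * (1 / ε ^ 2 * Wd W (1 - f r ^ 2)))) / r) r := by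
  obtain ⟨-, -, hf2, -, hode, -⟩ := H
  intro r hr
  have hr0 := hr.1.ne'
  have hn : Ioo (0:ℝ) 1 ∈ nhds r := isOpen_Ioo.mem_nhds hr
  have hd1 : DifferentiableAt ℝ f r :=
    ((hf2.differentiableOn two_ne_zero) r hr).differentiableAt hn
  have hd2 : DifferentiableAt ℝ (deriv f) r := by
    have : ContDiffOn ℝ 1 (deriv f) (Ioo 0 1) :=
      hf2.deriv_of_isOpen isOpen_Ioo (by norm_num)
    exact ((this.differentiableOn one_ne_zero) r hr).differentiableAt hn
  refine ⟨hd1.hasDerivAt.congr_deriv (by field_simp), ?_⟩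
  refine ((hasDerivAt_id r).mul hd2.hasDerivAt).congr_deriv ?_
  have h := hode r hr
  rw [hg r (Ioo_subset_Icc_self hr), zero_pow two_ne_zero, sub_zero] at h
  have h' : deriv (deriv f) r = -(1 / r * deriv f r) + (k : ℝ) ^ 2 / r ^ 2 * f r
      - 1 / ε ^ 2 * f r * Wd W (1 - f r ^ 2) := by linarith
  rw [h', sq_abs]
  simp only [id]
  field_simp
  ring

lemma IsEulerSolution.solvesSystem
    (H : IsEulerSolution |(k:ℝ)| (fun r => r ^ 2 * (1 / ε ^ 2 * f r * Wd W (1 - f r ^ 2))) f)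
    (hc : ContinuousOn (fun r => Wd W (1 - f r ^ 2)) (Icc 0 1)) :
    SolvesSystem W ε k f (fun _ => 0) := by
  obtain ⟨hf, h0, h1, p, hp⟩ := H
  have hderiv : ∀ r ∈ Ioo (0:ℝ) 1, deriv f r = p r / r := fun r hr => (hp r hr).1.deriv
  have hdd : ∀ r ∈ Ioo (0:ℝ) 1, HasDerivAt (deriv f) (-(1 / r * deriv f r) +
      (k : ℝ) ^ 2 / r ^ 2 * f r - 1 / ε ^ 2 * f r * Wd W (1 - f r ^ 2)) r := by
    intro r hr
    have hr0 := hr.1.ne'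
    have h := (hp r hr).2.div (hasDerivAt_id r) hr0
    refine (h.congr_deriv ?_).congr_of_eventuallyEq ?_
    · rw [hderiv r hr, sq_abs]
      simp only [id]
      field_simp
      ring
    · filter_upwards [isOpen_Ioo.mem_nhds hr] with x hx using hderiv x hx
  refine ⟨hf, continuousOn_const, ?_, contDiffOn_const, fun r hr => ?_, fun r _ => by simp,
    h0, h1, by simp, rfl⟩
  · rw [show (2 : WithTop ℕ∞) = 1 + 1 by norm_num, contDiffOn_succ_iff_deriv_of_isOpen isOpen_Ioo]
    refine ⟨fun r hr => (hp r hr).1.differentiableAt.differentiableWithinAt, by simp, ?_⟩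
    rw [show (1 : WithTop ℕ∞) = 0 + 1 by norm_num, contDiffOn_succ_iff_deriv_of_isOpen isOpen_Ioo]
    refine ⟨fun r hr => (hdd r hr).differentiableAt.differentiableWithinAt, by simp, ?_⟩
    rw [contDiffOn_zero]
    have hne : ∀ r ∈ Ioo (0:ℝ) 1, r ≠ 0 := fun r hr => hr.1.ne'
    have hd : ContinuousOn (deriv f) (Ioo 0 1) := fun r hr =>
      (hdd r hr).continuousAt.continuousWithinAt
    have hf' := hf.mono Ioo_subset_Icc_self
    refine ContinuousOn.congr ?_ fun r hr => (hdd r hr).deriv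
    exact ((((continuousOn_const.div continuousOn_id hne).mul hd).neg.add
      ((continuousOn_const.div (continuousOn_id.pow 2) fun r hr =>
        pow_ne_zero 2 (hne r hr)).mul hf')).sub
      ((continuousOn_const.mul hf').mul (hc.mono Ioo_subset_Icc_self)))
  · rw [(hdd r hr).deriv]
    simp only [zero_pow two_ne_zero, sub_zero]
    ring

end RadialSystem

/-- Theorem 1.1(3): for every `ε > 0` the radial system has exactly one
solution `(f̃, g̃)` with `f̃ > 0` on `(0,1)` and `g̃ ≡ 0`. -/
theorem statement_2
    (W : ℝ → ℝ) (hW : ContDiffOn ℝ 1 W (Iic (1:ℝ))) (hW0 : W 0 = 0)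
    (hWpos : ∀ t ∈ Iic (1:ℝ), t ≠ 0 → 0 < W t)
    (hWconv : StrictConvexOn ℝ (Iic (1:ℝ)) W)
    (k : ℤ) (hk : k ≠ 0) (ε : ℝ) (hε : 0 < ε) :
    (∃ f g : ℝ → ℝ, SolvesSystem W ε k f g ∧ (∀ r ∈ Ioo (0:ℝ) 1, 0 < f r) ∧
      ∀ r ∈ Icc (0:ℝ) 1, g r = 0) ∧
    ∀ f g f' g' : ℝ → ℝ,
      SolvesSystem W ε k f g → (∀ r ∈ Ioo (0:ℝ) 1, 0 < f r) → (∀ r ∈ Icc (0:ℝ) 1, g r = 0) →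
      SolvesSystem W ε k f' g' → (∀ r ∈ Ioo (0:ℝ) 1, 0 < f' r) →
      (∀ r ∈ Icc (0:ℝ) 1, g' r = 0) →
      EqOn f f' (Icc 0 1) := by
  have hk1 : 1 ≤ |(k:ℝ)| := by exact_mod_cast Int.one_le_abs hk
  have hk0 : 0 < |(k:ℝ)| := by linarith
  have hanti := strictAntiOn_scaled_Wd hW hWconv hε
  refine ⟨?_, fun f g f' g' H hpos hg H' hpos' hg' => ?_⟩
  · have hmap : MapsTo (fun x : ℝ => 1 - x ^ 2) univ (Iic 1) := fun x _ =>
      sub_le_self 1 (sq_nonneg x)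
    have hWc : Continuous fun x : ℝ => Wd W (1 - x ^ 2) :=
      continuousOn_univ.mp ((continuousOn_Wd hW).comp (by fun_prop) hmap)
    set clamp : ℝ → ℝ := fun x => max 0 (min 1 x) with hclamp
    have hclampc : Continuous clamp := by fun_prop
    have hclampI : ∀ x, clamp x ∈ Icc (0:ℝ) 1 := fun x =>
      ⟨le_max_left _ _, max_le zero_le_one (min_le_left _ _)⟩
    have hclampid : ∀ x ∈ Icc (0:ℝ) 1, clamp x = x := fun x hx => by
      simp [hclamp, hx.1, hx.2]
    have hWd : ∀ x ∈ Icc (0:ℝ) 1, 0 ≤ Wd W (1 - x ^ 2) := fun x hx => by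
      rw [← Wd_zero hW0 hWpos]
      have : x ^ 2 ≤ 1 := pow_le_one₀ hx.1 hx.2
      exact (strictMonoOn_Wd hW hWconv).monotoneOn (mem_Iic.mpr zero_le_one)
        (hmap (mem_univ x)) (by linarith)
    set G : ℝ → ℝ := fun x => 1 / ε ^ 2 * x * Wd W (1 - x ^ 2) with hG
    have hGc : Continuous G := (continuous_const.mul continuous_id).mul hWc
    obtain ⟨C, hC⟩ := isCompact_Icc.exists_bound_of_continuousOn
      (hGc.continuousOn (s := Icc (0:ℝ) 1))
    obtain ⟨f, hf, hbd⟩ := exists_isEulerSolution_nonlinear (F := fun x => G (clamp x)) hk1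
      (hGc.comp hclampc)
      (fun x => mul_nonneg (mul_nonneg (by positivity) (hclampI x).1) (hWd _ (hclampI x)))
      (fun x => (le_abs_self _).trans (hC _ (hclampI x)))
      (by simp [hG, hclamp, Wd_zero hW0 hWpos])
    have hfI : ∀ r ∈ Icc (0:ℝ) 1, f r ∈ Icc (0:ℝ) 1 := fun r hr =>
      ⟨(Real.rpow_nonneg hr.1 _).trans (hbd r hr).1, (hbd r hr).2⟩
    refine ⟨f, fun _ => 0, IsEulerSolution.solvesSystem (hf.shift fun r hr => ?_)
      (hWc.comp_continuousOn hf.continuousOn), fun r hr => ?_, fun _ _ => rfl⟩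
    · simp only [hclampid _ (hfI r (Ioo_subset_Icc_self hr)), hG]
    · exact (Real.rpow_pos_of_pos hr.1 _).trans_le (hbd r (Ioo_subset_Icc_self hr)).1
  · have hode := H.hasDerivAt_of_eq_zero hg
    have hode' := H'.hasDerivAt_of_eq_zero hg'
    obtain ⟨hf, -, -, -, -, -, h0, h1, -⟩ := H
    obtain ⟨hf', -, -, -, -, -, h0', h1', -⟩ := H'
    exact fun r hr => le_antisymm
      (le_of_positive_euler_solutions hk0 hanti hf h0 h1 hpos hode hf' h0' h1' hpos' hode' r hr)
      (le_of_positive_euler_solutions hk0 hanti hf' h0' h1' hpos' hode' hf h0 h1 hpos hode r hr)
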